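/- arXiv:2409.02940 — 4 statements merged into one kernel-verified Lean document; each statement's English description precedes it below -/
import Mathlib

section
/- Let r ≥ 2 and let J = (i_1, …, i_k) be a positive braid word with each i_t ∈ {1, …, r−1}. The ring homomorphism from ℤ[x_1, …, x_r, δ_1, …, δ_k] to the layered ring 𝒳_J sending x_i to X_{0,i} and δ_t to X_{t,i_t} − X_{t−1,i_t} descends to a ring isomorphism R_J ≅ 𝒳_J; moreover this isomorphism sends x_i + δ̂_i − δ̂_{i−1} to X_{k,i} for every i ∈ {1, …, r}. -/
noncomputable section
open MvPolynomial

/-- The polynomial ring `ℤ[x_1,…,x_r,δ_1,…,δ_l]` with `r = m + 2` strands: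
`Sum.inl` indexes the `x`'s and `Sum.inr` indexes the `δ`'s. -/
abbrev BSPoly (m l : ℕ) := MvPolynomial (Fin (m + 2) ⊕ Fin l) ℤ

/-- The Bott–Samelson relation attached to `t`:
`δ_t·(δ_t + x_{i_t} − x_{i_t+1} + 2·Σ_{s<t, i_s=i_t} δ_s − Σ_{s<t, |i_s−i_t|=1} δ_s)`.
Crossing indices are zero-based: `i t : Fin (m+1)` encodes the simple reflection between
strands `i t` and `i t + 1` (zero-based), so `x_{i_t} = X (Sum.inl (i t).castSucc)` and
`x_{i_t+1} = X (Sum.inl (i t).succ)`. -/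
def BSrel (m l : ℕ) (i : Fin l → Fin (m + 1)) (t : Fin l) : BSPoly m l :=
  X (Sum.inr t) *
    (X (Sum.inr t) + X (Sum.inl (i t).castSucc) - X (Sum.inl (i t).succ)
      + 2 * ∑ s ∈ Finset.univ.filter fun s => s < t ∧ i s = i t, X (Sum.inr s)
      - ∑ s ∈ Finset.univ.filter
          fun s => s < t ∧ ((i s : ℕ) = (i t : ℕ) + 1 ∨ (i t : ℕ) = (i s : ℕ) + 1),
          X (Sum.inr s))

/-- The Bott–Samelson ring `R_J = ℤ[x,δ]/I_J`. -/
abbrev BSRing (m l : ℕ) (i : Fin l → Fin (m + 1)) :=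
  BSPoly m l ⧸ Ideal.span (Set.range (BSrel m l i))

/-- `x_j ∈ R_J`. -/
def xB (m l : ℕ) (i : Fin l → Fin (m + 1)) (j : Fin (m + 2)) : BSRing m l i :=
  Ideal.Quotient.mk _ (X (Sum.inl j))

/-- `δ_t ∈ R_J`. -/
def δB (m l : ℕ) (i : Fin l → Fin (m + 1)) (t : Fin l) : BSRing m l i :=
  Ideal.Quotient.mk _ (X (Sum.inr t))

/-- `δ̂_c = Σ_{t : i_t = c} δ_t ∈ R_J`, indexed by an integer `c` so that the conventions
`δ̂_0 = δ̂_r = 0` (one-based) hold automatically. -/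
def δhat (m l : ℕ) (i : Fin l → Fin (m + 1)) (c : ℤ) : BSRing m l i :=
  ∑ t ∈ Finset.univ.filter fun t => ((i t : ℕ) : ℤ) = c, δB m l i t

/-- `y_j = x_j + δ̂_j − δ̂_{j−1} ∈ R_J` (zero-based `j`). -/
def yB (m l : ℕ) (i : Fin l → Fin (m + 1)) (j : Fin (m + 2)) : BSRing m l i :=
  xB m l i j + δhat m l i (j : ℤ) - δhat m l i ((j : ℤ) - 1)

/-- The ring homomorphism `ℤ[x_1,…,x_r,y_1,…,y_r] → R_J`, `x_j ↦ x_j`, `y_j ↦ y_j`. -/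
def toBS (m l : ℕ) (i : Fin l → Fin (m + 1)) :
    MvPolynomial (Fin (m + 2) ⊕ Fin (m + 2)) ℤ →+* BSRing m l i :=
  (MvPolynomial.aeval fun v => Sum.elim (xB m l i) (yB m l i) v).toRingHom

/-- The ring homomorphism `ℤ[x_1,…,x_r] → R_J`, `x_j ↦ x_j`. -/
def ψBS (m l : ℕ) (i : Fin l → Fin (m + 1)) :
    MvPolynomial (Fin (m + 2)) ℤ →+* BSRing m l i :=
  (MvPolynomial.aeval fun j => xB m l i j).toRingHom

/-- The polynomial ring `ℤ[X_{j,s}]` on layer–strand pairs, with `k + 1` layers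
`0,…,k` and `r = m + 2` strands. -/
abbrev LPoly (m k : ℕ) := MvPolynomial (Fin (k + 1) × Fin (m + 2)) ℤ

/-- The defining relations of the layered ring: for each crossing `t` (joining layers
`t` and `t+1` at the strands `i t` and `i t + 1`, all zero-based) the relations
`X_{t+1,i_t} + X_{t+1,i_t+1} − X_{t,i_t} − X_{t,i_t+1}`,
`X_{t+1,i_t}·X_{t+1,i_t+1} − X_{t,i_t}·X_{t,i_t+1}`, and
`X_{t+1,s} − X_{t,s}` for every strand `s ∉ {i_t, i_t + 1}`. -/
def LRelSet (m k : ℕ) (i : Fin k → Fin (m + 1)) : Set (LPoly m k) :=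
  {p | ∃ t : Fin k,
    p = X (t.succ, (i t).castSucc) + X (t.succ, (i t).succ)
        - X (t.castSucc, (i t).castSucc) - X (t.castSucc, (i t).succ) ∨
    p = X (t.succ, (i t).castSucc) * X (t.succ, (i t).succ)
        - X (t.castSucc, (i t).castSucc) * X (t.castSucc, (i t).succ) ∨
    ∃ s : Fin (m + 2), (s ≠ (i t).castSucc ∧ s ≠ (i t).succ) ∧
      p = X (t.succ, s) - X (t.castSucc, s)}

/-- The layered ring `𝒳_J`. -/
abbrev LRing (m k : ℕ) (i : Fin k → Fin (m + 1)) :=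
  LPoly m k ⧸ Ideal.span (LRelSet m k i)

/-- The contribution of the crossing `t` to the strand `s`: `d t` on the left strand of the
crossing, `-d t` on the right strand and `0` on all others. -/
def crossingShift {A : Type*} [CommRing A] {m k : ℕ} (i : Fin k → Fin (m + 1)) (d : Fin k → A)
    (s : Fin (m + 2)) (t : Fin k) : A :=
  (if (i t).castSucc = s then d t else 0) - (if (i t).succ = s then d t else 0)

/-- The value on the strand `s` after the first `n` crossings, starting from `x s`. -/
def layerValue {A : Type*} [CommRing A] {m k : ℕ} (i : Fin k → Fin (m + 1))
    (x : Fin (m + 2) → A) (d : Fin k → A) (n : ℕ) (s : Fin (m + 2)) : A :=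
  x s + ∑ t with t.val < n, crossingShift i d s t

section Layer

variable {A B : Type*} [CommRing A] [CommRing B] {m k : ℕ} (i : Fin k → Fin (m + 1))
  (x : Fin (m + 2) → A) (d : Fin k → A)

lemma crossingShift_castSucc (t : Fin k) : crossingShift i d (i t).castSucc t = d t := by
  have h : (i t).succ ≠ (i t).castSucc := (Fin.castSucc_lt_succ).ne'
  simp [crossingShift, h]

lemma crossingShift_succ (t : Fin k) : crossingShift i d (i t).succ t = -d t := by
  have h : (i t).castSucc ≠ (i t).succ := (Fin.castSucc_lt_succ).ne
  simp [crossingShift, h]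

lemma crossingShift_of_ne {s : Fin (m + 2)} {t : Fin k} (h : s ≠ (i t).castSucc)
    (h' : s ≠ (i t).succ) : crossingShift i d s t = 0 := by
  simp [crossingShift, h.symm, h'.symm]

lemma layerValue_zero (s : Fin (m + 2)) : layerValue i x d 0 s = x s := by
  simp [layerValue]

lemma layerValue_succ (t : Fin k) (s : Fin (m + 2)) :
    layerValue i x d (t + 1) s = layerValue i x d t s + crossingShift i d s t := by
  have h : (Finset.univ.filter fun u : Fin k => u.val < t + 1)
      = insert t (Finset.univ.filter fun u : Fin k => u.val < t) := by
    ext u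
    simp only [Finset.mem_filter, Finset.mem_univ, true_and, Finset.mem_insert, Fin.ext_iff]
    omega
  rw [layerValue, layerValue, h, Finset.sum_insert (by simp)]
  ring

lemma map_layerValue (f : A →+* B) (n : ℕ) (s : Fin (m + 2)) :
    f (layerValue i x d n s) = layerValue i (fun j => f (x j)) (fun t => f (d t)) n s := by
  simp [layerValue, crossingShift, apply_ite f]

lemma layerValue_castSucc_sub_succ (t : Fin k) :
    layerValue i x d t (i t).castSucc - layerValue i x d t (i t).succ =
      x (i t).castSucc - x (i t).succ
        + 2 * ∑ s ∈ Finset.univ.filter fun s => s < t ∧ i s = i t, d s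
        - ∑ s ∈ Finset.univ.filter
            fun s => s < t ∧ ((i s : ℕ) = (i t : ℕ) + 1 ∨ (i t : ℕ) = (i s : ℕ) + 1), d s := by
  have h : ∑ s with s.val < t.val, crossingShift i d (i t).castSucc s
        - ∑ s with s.val < t.val, crossingShift i d (i t).succ s
      = 2 * ∑ s ∈ Finset.univ.filter fun s => s < t ∧ i s = i t, d s
        - ∑ s ∈ Finset.univ.filter
            fun s => s < t ∧ ((i s : ℕ) = (i t : ℕ) + 1 ∨ (i t : ℕ) = (i s : ℕ) + 1), d s := by
    simp only [Finset.sum_filter, Finset.mul_sum, ← Finset.sum_sub_distrib]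
    refine Finset.sum_congr rfl fun s _ => ?_
    simp only [crossingShift, Fin.lt_def, Fin.ext_iff, Fin.val_castSucc, Fin.val_succ]
    split_ifs <;> first | (exfalso; omega) | ring
  rw [layerValue, layerValue]
  linear_combination h

end Layer

lemma BSrel_eq (m k : ℕ) (i : Fin k → Fin (m + 1)) (t : Fin k) :
    BSrel m k i t = X (Sum.inr t) * (X (Sum.inr t)
      + layerValue i (fun j => X (Sum.inl j)) (fun u => X (Sum.inr u)) t (i t).castSucc
      - layerValue i (fun j => X (Sum.inl j)) (fun u => X (Sum.inr u)) t (i t).succ) := by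
  rw [add_sub_assoc, layerValue_castSucc_sub_succ, BSrel]
  ring

lemma yB_eq_layerValue (m k : ℕ) (i : Fin k → Fin (m + 1)) (j : Fin (m + 2)) :
    yB m k i j = layerValue i (xB m k i) (δB m k i) k j := by
  simp only [yB, layerValue, δhat, Finset.sum_filter, add_sub_assoc, ← Finset.sum_sub_distrib]
  congr 1
  refine Finset.sum_congr rfl fun t _ => ?_
  simp only [crossingShift, Fin.ext_iff, Fin.val_castSucc, Fin.val_succ, t.isLt, if_true]
  split_ifs <;> first | (exfalso; omega) | rfl

/-- The class of the variable `X_{n,s}` in the layered ring. -/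
def layerVar (m k : ℕ) (i : Fin k → Fin (m + 1)) (n : Fin (k + 1)) (s : Fin (m + 2)) :
    LRing m k i :=
  Ideal.Quotient.mk _ (X (n, s))

/-- The element `X_{t,i_t} − X_{t−1,i_t}` of the layered ring. -/
def layerDiff (m k : ℕ) (i : Fin k → Fin (m + 1)) (t : Fin k) : LRing m k i :=
  layerVar m k i t.succ (i t).castSucc - layerVar m k i t.castSucc (i t).castSucc

section LRing

variable (m k : ℕ) (i : Fin k → Fin (m + 1))

lemma layerVar_add (t : Fin k) :
    layerVar m k i t.succ (i t).castSucc + layerVar m k i t.succ (i t).succ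
      = layerVar m k i t.castSucc (i t).castSucc + layerVar m k i t.castSucc (i t).succ := by
  have h := Ideal.Quotient.eq_zero_iff_mem.2
    (Ideal.subset_span (show _ ∈ LRelSet m k i from ⟨t, Or.inl rfl⟩))
  simp only [map_sub, map_add] at h
  simp only [layerVar]
  linear_combination h

lemma layerVar_mul (t : Fin k) :
    layerVar m k i t.succ (i t).castSucc * layerVar m k i t.succ (i t).succ
      = layerVar m k i t.castSucc (i t).castSucc * layerVar m k i t.castSucc (i t).succ := by
  have h := Ideal.Quotient.eq_zero_iff_mem.2
    (Ideal.subset_span (show _ ∈ LRelSet m k i from ⟨t, Or.inr (Or.inl rfl)⟩))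
  simp only [map_sub, map_mul] at h
  exact sub_eq_zero.1 h

lemma layerVar_of_ne {t : Fin k} {s : Fin (m + 2)} (hs : s ≠ (i t).castSucc)
    (hs' : s ≠ (i t).succ) : layerVar m k i t.succ s = layerVar m k i t.castSucc s := by
  have h := Ideal.Quotient.eq_zero_iff_mem.2
    (Ideal.subset_span (show _ ∈ LRelSet m k i from ⟨t, Or.inr (Or.inr ⟨s, ⟨hs, hs'⟩, rfl⟩)⟩))
  rw [map_sub] at h
  exact sub_eq_zero.1 h

lemma layerVar_eq_layerValue (n : Fin (k + 1)) (s : Fin (m + 2)) :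
    layerVar m k i n s = layerValue i (layerVar m k i 0) (layerDiff m k i) n s := by
  induction n using Fin.induction with
  | zero => simp [layerValue_zero]
  | succ t ih =>
    rw [Fin.val_castSucc] at ih
    rw [Fin.val_succ, layerValue_succ, ← ih]
    by_cases hs : s = (i t).castSucc
    · subst hs
      rw [crossingShift_castSucc, layerDiff]
      ring
    by_cases hs' : s = (i t).succ
    · subst hs'
      rw [crossingShift_succ, layerDiff]
      linear_combination layerVar_add m k i t
    · rw [crossingShift_of_ne i _ hs hs', layerVar_of_ne m k i hs hs', add_zero]

/-- The homomorphism `R_J → 𝒳_J` with `x_j ↦ X_{0,j}` and `δ_t ↦ X_{t,i_t} − X_{t−1,i_t}`. -/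
def bsToLayered : BSRing m k i →+* LRing m k i :=
  Ideal.Quotient.lift _
    (aeval (Sum.elim (layerVar m k i 0) (layerDiff m k i)) : BSPoly m k →ₐ[ℤ] LRing m k i).toRingHom
    (by
      intro p hp
      rw [← RingHom.mem_ker]
      refine Ideal.span_le.2 ?_ hp
      rintro _ ⟨t, rfl⟩
      have h (s : Fin (m + 2)) := layerVar_eq_layerValue m k i t.castSucc s
      simp only [Fin.val_castSucc] at h
      rw [SetLike.mem_coe, RingHom.mem_ker, BSrel_eq, map_mul, map_sub, map_add, map_layerValue,
        map_layerValue]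
      simp only [AlgHom.toRingHom_eq_coe, RingHom.coe_coe, aeval_X, Sum.elim_inl, Sum.elim_inr]
      rw [← h, ← h, layerDiff]
      linear_combination layerVar m k i t.succ (i t).castSucc * layerVar_add m k i t
        - layerVar_mul m k i t)

lemma bsToLayered_mk (p : BSPoly m k) :
    bsToLayered m k i (Ideal.Quotient.mk _ p)
      = aeval (Sum.elim (layerVar m k i 0) (layerDiff m k i)) p := rfl

lemma bsToLayered_layerValue (n : Fin (k + 1)) (s : Fin (m + 2)) :
    bsToLayered m k i (layerValue i (xB m k i) (δB m k i) n s) = layerVar m k i n s := by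
  simp [map_layerValue, xB, δB, bsToLayered_mk, layerVar_eq_layerValue m k i n s]

lemma δB_mul_eq_zero (t : Fin k) :
    δB m k i t * (δB m k i t + layerValue i (xB m k i) (δB m k i) t (i t).castSucc
      - layerValue i (xB m k i) (δB m k i) t (i t).succ) = 0 := by
  have h : Ideal.Quotient.mk (Ideal.span (Set.range (BSrel m k i))) (BSrel m k i t) = 0 :=
    Ideal.Quotient.eq_zero_iff_mem.2 (Ideal.subset_span ⟨t, rfl⟩)
  rw [BSrel_eq, map_mul, map_sub, map_add, map_layerValue, map_layerValue] at h
  exact h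

/-- The homomorphism `𝒳_J → R_J` sending `X_{n,s}` to the value on the strand `s` after `n`
crossings. -/
def layeredToBS : LRing m k i →+* BSRing m k i :=
  Ideal.Quotient.lift _
    (aeval fun v : Fin (k + 1) × Fin (m + 2) =>
      layerValue i (xB m k i) (δB m k i) v.1 v.2 : LPoly m k →ₐ[ℤ] BSRing m k i).toRingHom
    (by
      intro p hp
      rw [← RingHom.mem_ker]
      refine Ideal.span_le.2 ?_ hp
      rintro _ ⟨t, rfl | rfl | ⟨s, ⟨hs, hs'⟩, rfl⟩⟩ <;>
        simp only [SetLike.mem_coe, RingHom.mem_ker, AlgHom.toRingHom_eq_coe, RingHom.coe_coe,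
          map_sub, map_add, map_mul, aeval_X, Fin.val_succ, Fin.val_castSucc, layerValue_succ,
          crossingShift_castSucc, crossingShift_succ]
      · ring
      · linear_combination -δB_mul_eq_zero m k i t
      · rw [crossingShift_of_ne i _ hs hs', add_zero, sub_self])

lemma layeredToBS_layerVar (n : Fin (k + 1)) (s : Fin (m + 2)) :
    layeredToBS m k i (layerVar m k i n s) = layerValue i (xB m k i) (δB m k i) n s := by
  change aeval _ (X (n, s)) = _
  rw [aeval_X]

lemma bsToLayered_comp_layeredToBS :
    (bsToLayered m k i).comp (layeredToBS m k i) = RingHom.id _ := by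
  refine Ideal.Quotient.ringHom_ext (MvPolynomial.ringHom_ext (by simp) ?_)
  rintro ⟨n, s⟩
  change bsToLayered m k i (layeredToBS m k i (layerVar m k i n s)) = layerVar m k i n s
  rw [layeredToBS_layerVar, bsToLayered_layerValue]

lemma layeredToBS_comp_bsToLayered :
    (layeredToBS m k i).comp (bsToLayered m k i) = RingHom.id _ := by
  refine Ideal.Quotient.ringHom_ext (MvPolynomial.ringHom_ext (by simp) ?_)
  rintro (j | t)
  · change layeredToBS m k i (aeval _ (X (Sum.inl j))) = xB m k i j
    rw [aeval_X, Sum.elim_inl, layeredToBS_layerVar, Fin.val_zero, layerValue_zero]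
  · change layeredToBS m k i (aeval _ (X (Sum.inr t))) = δB m k i t
    rw [aeval_X, Sum.elim_inr, layerDiff, map_sub, layeredToBS_layerVar, layeredToBS_layerVar,
      Fin.val_succ, Fin.val_castSucc, layerValue_succ, crossingShift_castSucc, add_sub_cancel_left]

end LRing

/-- Let `r = m + 2 ≥ 2` and let `J = (i_1,…,i_k)` be a positive braid
word.  The ring homomorphism `ℤ[x_1,…,x_r,δ_1,…,δ_k] → 𝒳_J` sending `x_j ↦ X_{0,j}`
and `δ_t ↦ X_{t,i_t} − X_{t−1,i_t}` descends to a ring isomorphism `R_J ≅ 𝒳_J`;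
moreover this isomorphism sends `y_j = x_j + δ̂_j − δ̂_{j−1}` to `X_{k,j}` for every
strand `j`. -/
theorem stmt0 (m k : ℕ) (i : Fin k → Fin (m + 1)) :
    ∃ e : BSRing m k i ≃+* LRing m k i,
      (∀ p : BSPoly m k,
        e (Ideal.Quotient.mk _ p) =
          MvPolynomial.aeval
            (Sum.elim
              (fun j : Fin (m + 2) =>
                (Ideal.Quotient.mk _ (X ((0 : Fin (k + 1)), j)) : LRing m k i))
              (fun t : Fin k =>
                Ideal.Quotient.mk _ (X (t.succ, (i t).castSucc))
                  - Ideal.Quotient.mk _ (X (t.castSucc, (i t).castSucc)))) p) ∧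
      ∀ j : Fin (m + 2),
        e (yB m k i j) = Ideal.Quotient.mk _ (X (Fin.last k, j)) := by
  refine ⟨RingEquiv.ofRingHom (bsToLayered m k i) (layeredToBS m k i)
    (bsToLayered_comp_layeredToBS m k i) (layeredToBS_comp_bsToLayered m k i),
    fun p => bsToLayered_mk m k i p, fun j => ?_⟩
  rw [yB_eq_layerValue]
  exact bsToLayered_layerValue m k i (Fin.last k) j
end
end

section
/- Let r ≥ 2 and let J = (i_1, …, i_k) be a positive braid word with each i_t ∈ {1, …, r−1}. In the layered ring 𝒳_J, for every t ∈ {1, …, k} the identity X_{t−1,i_t} − X_{t−1,i_t+1} = (X_{0,i_t} − X_{0,i_t+1}) + 2·Σ_{s<t, i_s=i_t}(X_{s,i_s} − X_{s−1,i_s}) − Σ_{s<t, |i_s−i_t|=1}(X_{s,i_s} − X_{s−1,i_s}) holds. -/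
noncomputable section
open MvPolynomial
/-- A sum over the indices before `t.succ` splits off the term at `t`. -/
lemma sum_filter_castSucc_lt_succ {R : Type*} [CommRing R] {k : ℕ} (P : Fin k → Prop)
    [DecidablePred P] (f : Fin k → R) (t : Fin k) :
    ∑ s ∈ Finset.univ.filter fun s => s.castSucc < t.succ ∧ P s, f s
      = (∑ s ∈ Finset.univ.filter fun s => s.castSucc < t.castSucc ∧ P s, f s)
        + if P t then f t else 0 := by
  have hsingle : (if P t then f t else 0) = ∑ s, if s = t then (if P s then f s else 0) else 0 := by
    simp
  rw [hsingle, Finset.sum_filter, Finset.sum_filter, ← Finset.sum_add_distrib]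
  refine Finset.sum_congr rfl fun s _ => ?_
  simp only [Fin.castSucc_lt_succ_iff, Fin.castSucc_lt_castSucc_iff, le_iff_lt_or_eq]
  by_cases h : s = t
  · simp [h]
  · simp [h]

/-- How the difference of two neighbouring strands changes across a crossing, using only the
linear relations. -/
lemma strand_difference_step {R : Type*} [CommRing R] {m k : ℕ} (i : Fin k → Fin (m + 1))
    (x : Fin (k + 1) → Fin (m + 2) → R)
    (hadd : ∀ t, x t.succ (i t).castSucc + x t.succ (i t).succ
      = x t.castSucc (i t).castSucc + x t.castSucc (i t).succ)
    (hfix : ∀ t s, s ≠ (i t).castSucc → s ≠ (i t).succ → x t.succ s = x t.castSucc s)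
    (a : Fin (m + 1)) (t : Fin k) :
    x t.succ a.castSucc - x t.succ a.succ
      = x t.castSucc a.castSucc - x t.castSucc a.succ
        + 2 * (if i t = a then x t.succ (i t).castSucc - x t.castSucc (i t).castSucc else 0)
        - (if (i t : ℕ) = (a : ℕ) + 1 ∨ (a : ℕ) = (i t : ℕ) + 1 then
            x t.succ (i t).castSucc - x t.castSucc (i t).castSucc else 0) := by
  have ha := hadd t
  by_cases h : i t = a
  · rw [h] at ha
    simp only [h, if_true, Nat.left_eq_add, one_ne_zero, or_self, if_false]
    linear_combination -ha
  have hne : (i t : ℕ) ≠ a := fun h' => h (Fin.ext h')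
  by_cases h₁ : (i t : ℕ) = (a : ℕ) + 1
  · have hs : a.succ = (i t).castSucc := Fin.ext (by simp [h₁])
    have hc : x t.succ a.castSucc = x t.castSucc a.castSucc := by
      apply hfix <;> simp [Fin.ext_iff] <;> omega
    rw [if_neg h, if_pos (Or.inl h₁), hs]
    linear_combination hc
  by_cases h₂ : (a : ℕ) = (i t : ℕ) + 1
  · have hs : a.castSucc = (i t).succ := Fin.ext (by simp [h₂])
    have hc : x t.succ a.succ = x t.castSucc a.succ := by
      apply hfix <;> simp [Fin.ext_iff] <;> omega
    rw [if_neg h, if_pos (Or.inr h₂), hs]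
    linear_combination ha - hc
  have hc : x t.succ a.castSucc = x t.castSucc a.castSucc := by
    apply hfix <;> simp [Fin.ext_iff] <;> omega
  have hs : x t.succ a.succ = x t.castSucc a.succ := by
    apply hfix <;> simp [Fin.ext_iff] <;> omega
  rw [if_neg h, if_neg (not_or.mpr ⟨h₁, h₂⟩)]
  linear_combination hc - hs

/-- The difference of two neighbouring strands at layer `j`, expressed through the bottom layer
and the increments at earlier crossings. -/
lemma strand_difference_eq {R : Type*} [CommRing R] {m k : ℕ} (i : Fin k → Fin (m + 1))
    (x : Fin (k + 1) → Fin (m + 2) → R)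
    (hadd : ∀ t, x t.succ (i t).castSucc + x t.succ (i t).succ
      = x t.castSucc (i t).castSucc + x t.castSucc (i t).succ)
    (hfix : ∀ t s, s ≠ (i t).castSucc → s ≠ (i t).succ → x t.succ s = x t.castSucc s)
    (a : Fin (m + 1)) (j : Fin (k + 1)) :
    x j a.castSucc - x j a.succ
      = (x 0 a.castSucc - x 0 a.succ)
        + 2 * ∑ s ∈ Finset.univ.filter fun s => s.castSucc < j ∧ i s = a,
          (x s.succ (i s).castSucc - x s.castSucc (i s).castSucc)
        - ∑ s ∈ Finset.univ.filter fun s : Fin k =>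
            s.castSucc < j ∧ ((i s : ℕ) = (a : ℕ) + 1 ∨ (a : ℕ) = (i s : ℕ) + 1),
          (x s.succ (i s).castSucc - x s.castSucc (i s).castSucc) := by
  induction j using Fin.induction with
  | zero => simp
  | succ t ih =>
    rw [sum_filter_castSucc_lt_succ, sum_filter_castSucc_lt_succ,
      strand_difference_step i x hadd hfix, ih]
    ring

/-- Let `r = m + 2 ≥ 2` and let `J = (i_1,…,i_k)` be a positive braid
word.  In the layered ring `𝒳_J`, for every crossing `t` (zero-based, joining layers
`t` and `t+1`) one has
`X_{t,i_t} − X_{t,i_t+1} = (X_{0,i_t} − X_{0,i_t+1})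
  + 2·Σ_{s<t, i_s=i_t} (X_{s+1,i_s} − X_{s,i_s})
  − Σ_{s<t, |i_s−i_t|=1} (X_{s+1,i_s} − X_{s,i_s})`. -/
theorem stmt1 (m k : ℕ) (i : Fin k → Fin (m + 1)) (t : Fin k) :
    (Ideal.Quotient.mk (Ideal.span (LRelSet m k i))
        (X (t.castSucc, (i t).castSucc))
      - Ideal.Quotient.mk _ (X (t.castSucc, (i t).succ)))
    = (Ideal.Quotient.mk _ (X ((0 : Fin (k + 1)), (i t).castSucc))
        - Ideal.Quotient.mk _ (X ((0 : Fin (k + 1)), (i t).succ)))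
      + 2 * ∑ s ∈ Finset.univ.filter fun s => s < t ∧ i s = i t,
          (Ideal.Quotient.mk _ (X (s.succ, (i s).castSucc))
            - Ideal.Quotient.mk _ (X (s.castSucc, (i s).castSucc)))
      - ∑ s ∈ Finset.univ.filter
            fun s => s < t ∧ ((i s : ℕ) = (i t : ℕ) + 1 ∨ (i t : ℕ) = (i s : ℕ) + 1),
          (Ideal.Quotient.mk _ (X (s.succ, (i s).castSucc))
            - Ideal.Quotient.mk _ (X (s.castSucc, (i s).castSucc))) := by
  have hmem {p : LPoly m k} (hp : p ∈ LRelSet m k i) :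
      Ideal.Quotient.mk (Ideal.span (LRelSet m k i)) p = 0 :=
    Ideal.Quotient.eq_zero_iff_mem.mpr (Ideal.subset_span hp)
  have key := strand_difference_eq i
    (fun j s => Ideal.Quotient.mk (Ideal.span (LRelSet m k i)) (X (j, s)))
    (fun t => by
      have h := hmem ⟨t, Or.inl rfl⟩
      simp only [map_sub, map_add] at h
      linear_combination h)
    (fun t s h₁ h₂ => by
      have h := hmem ⟨t, Or.inr (Or.inr ⟨s, ⟨h₁, h₂⟩, rfl⟩)⟩
      rw [map_sub] at h
      exact sub_eq_zero.mp h)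
    (i t) t.castSucc
  simpa only [Fin.castSucc_lt_castSucc_iff] using key
end
end

section
/- Let r ≥ 1. In the ring 𝔉 the identity Σ_{k=1}^{r−1} (x_{k+1} − x_k)·S_k = Σ_{k=1}^{r−1} S_k·(S_k − S_{k+1}) holds. -/
noncomputable section
open MvPolynomial

/-- The `k`-th elementary symmetric function of a finite family of ring elements:
`e_k(v) = Σ_{S ⊆ ι, |S| = k} Π_{j ∈ S} v j`. -/
def esym {R : Type*} [CommRing R] {ι : Type*} [Fintype ι] [DecidableEq ι]
    (k : ℕ) (v : ι → R) : R :=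
  ∑ S ∈ Finset.univ.powersetCard k, ∏ j ∈ S, v j

/-- The polynomial ring `ℤ[x_1,…,x_r,y_1,…,y_r]`: `Sum.inl` indexes the `x`'s and
`Sum.inr` indexes the `y`'s. -/
abbrev FPoly (r : ℕ) := MvPolynomial (Fin r ⊕ Fin r) ℤ

/-- The relation `e_{j+1}(x) − e_{j+1}(y)` (so the degrees `1,…,r` occur as `j` runs
through `Fin r`). -/
def Frel (r : ℕ) (j : Fin r) : FPoly r :=
  esym ((j : ℕ) + 1) (fun i : Fin r => (X (Sum.inl i) : FPoly r)) -
    esym ((j : ℕ) + 1) (fun i : Fin r => (X (Sum.inr i) : FPoly r))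

/-- The ring `𝔉 = ℤ[x,y]/(e_1(x) − e_1(y), …, e_r(x) − e_r(y))`. -/
abbrev FRing (r : ℕ) := FPoly r ⧸ Ideal.span (Set.range (Frel r))

/-- `x_{j+1}` (zero-based index `j`) in `𝔉`; junk value `0` for `j ≥ r`. -/
def xF (r : ℕ) (j : ℕ) : FRing r :=
  if h : j < r then Ideal.Quotient.mk _ (X (Sum.inl ⟨j, h⟩)) else 0

/-- `y_{j+1}` (zero-based index `j`) in `𝔉`; junk value `0` for `j ≥ r`. -/
def yF (r : ℕ) (j : ℕ) : FRing r :=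
  if h : j < r then Ideal.Quotient.mk _ (X (Sum.inr ⟨j, h⟩)) else 0

/-- `S_m = Σ_{i=1}^m (y_i − x_i) ∈ 𝔉` for `0 ≤ m ≤ r − 1`, with the convention
`S_m = 0` for `m ≥ r` (in particular `S_r = 0`). -/
def SF (r : ℕ) (m : ℕ) : FRing r :=
  if m < r then ∑ j ∈ Finset.range m, (yF r j - xF r j) else 0

theorem sum_powersetCard_two_range {R : Type*} [CommRing R] (v : ℕ → R) (n : ℕ) :
    ∑ S ∈ (Finset.range n).powersetCard 2, ∏ j ∈ S, v j
      = ∑ i ∈ Finset.range n, v i * ∑ j ∈ Finset.range i, v j := by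
  induction n with
  | zero => rw [Finset.powersetCard_eq_empty.2 (by simp)]; simp
  | succ n ih =>
    have hn : n ∉ Finset.range n := by simp
    rw [Finset.sum_range_succ, ← ih, Finset.range_add_one,
      Finset.powersetCard_succ_insert hn, Finset.sum_union, Finset.sum_image]
    · congr 1
      rw [Finset.powersetCard_one, Finset.sum_map, Finset.mul_sum]
      refine Finset.sum_congr rfl fun j hj => ?_
      have hne : n ≠ j := by
        rintro rfl
        exact hn hj
      simp [Finset.prod_pair hne]
    · intro S hS T hT h
      have hS' : n ∉ S := fun h => hn ((Finset.mem_powersetCard.1 hS).1 h)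
      have hT' : n ∉ T := fun h => hn ((Finset.mem_powersetCard.1 hT).1 h)
      rw [← Finset.erase_insert hS', ← Finset.erase_insert hT', h]
    · rw [Finset.disjoint_left]
      intro S hS hS'
      obtain ⟨T, -, rfl⟩ := Finset.mem_image.1 hS'
      exact hn ((Finset.mem_powersetCard.1 hS).1 (Finset.mem_insert_self _ _))

theorem esym_fin {R : Type*} [CommRing R] (r k : ℕ) (v : ℕ → R) :
    esym k (fun i : Fin r => v i)
      = ∑ S ∈ (Finset.range r).powersetCard k, ∏ j ∈ S, v j := by
  have h : Finset.range r = (Finset.univ : Finset (Fin r)).map Fin.valEmbedding := by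
    ext a
    simp
  rw [h, Finset.powersetCard_map, Finset.sum_map]
  simp [esym]

theorem map_esym {R A : Type*} [CommRing R] [CommRing A] {ι : Type*} [Fintype ι]
    [DecidableEq ι] (f : R →+* A) (k : ℕ) (v : ι → R) :
    f (esym k v) = esym k (fun i => f (v i)) := by
  simp [esym, map_sum, map_prod]

theorem esym_xF_eq_esym_yF (r k : ℕ) (hk : k < r) :
    esym (k + 1) (fun i : Fin r => xF r i) = esym (k + 1) (fun i : Fin r => yF r i) := by
  have h : Ideal.Quotient.mk (Ideal.span (Set.range (Frel r))) (Frel r ⟨k, hk⟩) = 0 :=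
    Ideal.Quotient.eq_zero_iff_mem.2 (Ideal.subset_span ⟨_, rfl⟩)
  rw [Frel, map_sub, map_esym, map_esym, sub_eq_zero] at h
  simpa [xF, yF] using h

theorem sum_xF_eq_sum_yF (r : ℕ) (hr : 1 ≤ r) :
    ∑ j ∈ Finset.range r, xF r j = ∑ j ∈ Finset.range r, yF r j := by
  have h := esym_xF_eq_esym_yF r 0 hr
  rw [esym_fin, esym_fin] at h
  simpa [Finset.powersetCard_one] using h

theorem SF_eq_sum (r m : ℕ) (hr : 1 ≤ r) (hm : m ≤ r) :
    SF r m = ∑ j ∈ Finset.range m, (yF r j - xF r j) := by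
  rw [SF]
  split_ifs with h
  · rfl
  · obtain rfl : m = r := by omega
    rw [Finset.sum_sub_distrib, sum_xF_eq_sum_yF m hr, sub_self]

/-- Summation by parts, with the boundary terms made explicit. -/
theorem sum_mul_partial_sums {R : Type*} [CommRing R] (x y T : ℕ → R)
    (hT : ∀ m, T m = ∑ j ∈ Finset.range m, (y j - x j)) (n : ℕ) :
    ∑ k ∈ Finset.range n, (x (k + 1) - x k) * T (k + 1)
      = ∑ k ∈ Finset.range n, T (k + 1) * (T (k + 1) - T (k + 2))
        + (x n - ∑ j ∈ Finset.range (n + 1), x j) * T (n + 1)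
        + (∑ i ∈ Finset.range (n + 1), y i * ∑ j ∈ Finset.range i, y j)
        - ∑ i ∈ Finset.range (n + 1), x i * ∑ j ∈ Finset.range i, x j := by
  have hs : ∀ m, T (m + 1) = T m + (y m - x m) := fun m => by
    rw [hT, hT, Finset.sum_range_succ]
  have hd : ∀ m, T m = ∑ j ∈ Finset.range m, y j - ∑ j ∈ Finset.range m, x j := fun m => by
    rw [hT, Finset.sum_sub_distrib]
  induction n with
  | zero => simp
  | succ n ih =>
    have hn : T (n + 2) = T (n + 1) + (y (n + 1) - x (n + 1)) := hs (n + 1)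
    rw [Finset.sum_range_succ, ih,
      Finset.sum_range_succ (fun k => T (k + 1) * (T (k + 1) - T (k + 2))) n,
      Finset.sum_range_succ (fun i => y i * ∑ j ∈ Finset.range i, y j) (n + 1),
      Finset.sum_range_succ (fun i => x i * ∑ j ∈ Finset.range i, x j) (n + 1),
      Finset.sum_range_succ x (n + 1), hn, hd (n + 1)]
    ring

/-- For `r ≥ 1`, in the ring `𝔉` the identity
`Σ_{k=1}^{r−1} (x_{k+1} − x_k)·S_k = Σ_{k=1}^{r−1} S_k·(S_k − S_{k+1})` holds
(zero-based: `x_k = xF r (k−1)`, and the summation index below is `k − 1`). -/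
theorem stmt4 (r : ℕ) (hr : 1 ≤ r) :
    ∑ k ∈ Finset.range (r - 1), (xF r (k + 1) - xF r k) * SF r (k + 1)
      = ∑ k ∈ Finset.range (r - 1), SF r (k + 1) * (SF r (k + 1) - SF r (k + 2)) := by
  obtain ⟨n, rfl⟩ : ∃ n, r = n + 1 := ⟨r - 1, by omega⟩
  set T : ℕ → FRing (n + 1) :=
    fun m => ∑ j ∈ Finset.range m, (yF (n + 1) j - xF (n + 1) j)
  have hS : ∀ m ≤ n + 1, SF (n + 1) m = T m := fun m hm => SF_eq_sum _ _ hr hm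
  have hl : ∑ k ∈ Finset.range n, (xF (n + 1) (k + 1) - xF (n + 1) k) * SF (n + 1) (k + 1)
      = ∑ k ∈ Finset.range n, (xF (n + 1) (k + 1) - xF (n + 1) k) * T (k + 1) :=
    Finset.sum_congr rfl fun k hk => by
      have := Finset.mem_range.1 hk
      rw [hS _ (by omega)]
  have hR : ∑ k ∈ Finset.range n, SF (n + 1) (k + 1) * (SF (n + 1) (k + 1) - SF (n + 1) (k + 2))
      = ∑ k ∈ Finset.range n, T (k + 1) * (T (k + 1) - T (k + 2)) :=
    Finset.sum_congr rfl fun k hk => by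
      have := Finset.mem_range.1 hk
      rw [hS _ (by omega), hS _ (by omega)]
  rw [Nat.add_sub_cancel, hl, hR]
  rcases Nat.eq_zero_or_pos n with rfl | hn
  · simp
  have h0 : T (n + 1) = 0 := by
    rw [← hS _ le_rfl, SF, if_neg (lt_irrefl _)]
  have h2 := esym_xF_eq_esym_yF (n + 1) 1 (by omega)
  rw [esym_fin, esym_fin, sum_powersetCard_two_range, sum_powersetCard_two_range] at h2
  rw [sum_mul_partial_sums (xF (n + 1)) (yF (n + 1)) T (fun _ => rfl), h0, h2]
  ring
end
end

section
/- Fix integers r ≥ 1 and n ≥ 1, and let 𝔉_ℚ := ℚ ⊗_ℤ 𝔉. In the Koszul complex K(𝔉_ℚ; x_1 − y_1, …, x_r − y_r), the exterior-degree-1 element κ_n := (1/(n+1))·Σ_{j=1}^r (Σ_{i=0}^n x_j^i·y_j^{n−i})·x̂_j satisfies d(κ_n) = 0, and there exists a cycle z of exterior degree 1 in the integral Koszul complex K(𝔉; x_1 − y_1, …, x_r − y_r) whose image in K(𝔉_ℚ; x_1 − y_1, …, x_r − y_r) is homologous to κ_n, i.e. the image of z minus κ_n lies in the image under d of the exterior-degree-2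 part. (In other words, the rational Hochschild homology class of κ_n is integral.) -/
noncomputable section
open MvPolynomial

/-- The rational version `ℚ ⊗ 𝔉`: the polynomial ring `ℚ[x,y]` modulo the images of the
relations `e_j(x) − e_j(y)`. -/
abbrev FQRing (r : ℕ) :=
  MvPolynomial (Fin r ⊕ Fin r) ℚ ⧸
    Ideal.span (Set.range fun j => MvPolynomial.map (Int.castRingHom ℚ) (Frel r j))

/-- The canonical ring homomorphism `𝔉 → ℚ ⊗ 𝔉` at the level of representatives:
`ℤ[x,y] → ℚ ⊗ 𝔉`. -/
def toFQ (r : ℕ) : FPoly r →+* FQRing r :=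
  (Ideal.Quotient.mk _).comp (MvPolynomial.map (Int.castRingHom ℚ))

/-- `x_j` in `𝔉`. -/
def xZ (r : ℕ) (j : Fin r) : FRing r := Ideal.Quotient.mk _ (X (Sum.inl j))

/-- `y_j` in `𝔉`. -/
def yZ (r : ℕ) (j : Fin r) : FRing r := Ideal.Quotient.mk _ (X (Sum.inr j))

/-- `x_j` in `ℚ ⊗ 𝔉`. -/
def xQ (r : ℕ) (j : Fin r) : FQRing r := toFQ r (X (Sum.inl j))

/-- `y_j` in `ℚ ⊗ 𝔉`. -/
def yQ (r : ℕ) (j : Fin r) : FQRing r := toFQ r (X (Sum.inr j))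

/-- The `j`-th coefficient of `κ_n = (1/(n+1))·Σ_j (Σ_{i=0}^n x_j^i·y_j^{n−i})·x̂_j`. -/
def kappa (r n : ℕ) (j : Fin r) : FQRing r :=
  algebraMap ℚ (FQRing r) (1 / (n + 1)) *
    ∑ i ∈ Finset.range (n + 1), xQ r j ^ i * yQ r j ^ (n - i)

/-- The geometric series `Σ_k v^k t^k` is inverse to `1 - v t`. -/
lemma mk_pow_mul_one_sub {R : Type*} [CommRing R] (v : R) :
    PowerSeries.mk (fun k => v ^ k) * (1 - PowerSeries.C v * PowerSeries.X) = 1 := by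
  ext n
  rw [mul_sub, mul_one, mul_left_comm, ← mul_assoc, map_sub]
  cases n with
  | zero => simp
  | succ n => simp [PowerSeries.coeff_succ_mul_X, PowerSeries.coeff_one, pow_succ']

/-- A derivation multiplies a product by the sum of the logarithmic derivatives. -/
lemma derivation_prod_of_forall {R A ι : Type*} [CommRing R] [CommRing A] [Algebra R A]
    (D : Derivation R A A) (s : Finset ι) (f g : ι → A) (h : ∀ i ∈ s, D (f i) = g i * f i) :
    D (∏ i ∈ s, f i) = (∑ i ∈ s, g i) * ∏ i ∈ s, f i := by
  classical
  induction s using Finset.induction_on with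
  | empty => simp
  | insert a s ha ih =>
    rw [Finset.prod_insert ha, Finset.sum_insert ha, Derivation.leibniz,
      ih fun i hi => h i (Finset.mem_insert_of_mem hi), h a (Finset.mem_insert_self a s)]
    simp only [smul_eq_mul]
    ring

/-- The logarithmic derivative of `(1 - w t) / (1 - v t)` is `Σ_k (v^{k+1} - w^{k+1}) t^k`. -/
lemma derivative_one_sub_mul_mk_pow {R : Type*} [CommRing R] (v w : R) :
    PowerSeries.derivative R
        ((1 - PowerSeries.C w * PowerSeries.X) * PowerSeries.mk fun k => v ^ k) =
      PowerSeries.mk (fun k => v ^ (k + 1) - w ^ (k + 1)) *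
        ((1 - PowerSeries.C w * PowerSeries.X) * PowerSeries.mk fun k => v ^ k) := by
  have hlin (u : R) : PowerSeries.derivative R (1 - PowerSeries.C u * PowerSeries.X) =
      -PowerSeries.C u := by
    rw [map_sub, Derivation.map_one_eq_zero, Derivation.leibniz]
    simp [PowerSeries.derivative_C, PowerSeries.derivative_X]
  have hinv := congrArg (PowerSeries.derivative R) (mk_pow_mul_one_sub v)
  rw [Derivation.leibniz, hlin, Derivation.map_one_eq_zero, smul_eq_mul, smul_eq_mul] at hinv
  have hmk : PowerSeries.mk (fun k => v ^ (k + 1) - w ^ (k + 1)) =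
      PowerSeries.C v * PowerSeries.mk (fun k => v ^ k) -
        PowerSeries.C w * PowerSeries.mk (fun k => w ^ k) := by
    ext n
    simp [pow_succ']
  rw [Derivation.leibniz, hlin, hmk, smul_eq_mul, smul_eq_mul]
  have hv := mk_pow_mul_one_sub v
  have hw := mk_pow_mul_one_sub w
  set Gv := PowerSeries.mk fun k => v ^ k
  set Gw := PowerSeries.mk fun k => w ^ k
  linear_combination (1 - PowerSeries.C w * PowerSeries.X) *
    (Gv * hinv - PowerSeries.derivative R Gv * hv) + PowerSeries.C w * Gv * hw

/-- `Π_i (1 - v_i t)` is the signed generating polynomial of the elementary symmetric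
functions of `v`. -/
lemma prod_one_sub_eq_sum_esym {R ι : Type*} [CommRing R] [Fintype ι] [DecidableEq ι]
    (v : ι → R) :
    ∏ i, (1 - PowerSeries.C (v i) * PowerSeries.X) =
      ∑ k ∈ Finset.range (Fintype.card ι + 1),
        PowerSeries.C ((-1) ^ k * esym k v) * PowerSeries.X ^ k := by
  simp_rw [sub_eq_add_neg]
  rw [Finset.prod_one_add, Finset.sum_powerset]
  refine Finset.sum_congr rfl fun k _ => ?_
  rw [esym, Finset.mul_sum, map_sum, Finset.sum_mul]
  refine Finset.sum_congr rfl fun S hS => ?_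
  rw [Finset.prod_neg, Finset.prod_mul_distrib, Finset.prod_const,
    (Finset.mem_powersetCard.mp hS).2, map_mul, map_prod]
  simp [mul_assoc]

/-- If the elementary symmetric functions of `v` and `w` agree modulo `I`, then the divided
difference `(p_{n+1}(v) - p_{n+1}(w)) / (n+1)` of power sums is, modulo `I ^ 2`, an element
of `I` with no denominators. -/
lemma exists_mem_psum_sub_mem_sq {R ι : Type*} [CommRing R] [Fintype ι] [DecidableEq ι]
    (I : Ideal R) (v w : ι → R)
    (h : ∀ k < Fintype.card ι, esym (k + 1) v - esym (k + 1) w ∈ I) (n : ℕ) :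
    (∑ i, (v i ^ (n + 1) - w i ^ (n + 1)) ∈ I) ∧
      ∃ g ∈ I, (n + 1 : R) * g - ∑ i, (v i ^ (n + 1) - w i ^ (n + 1)) ∈ I ^ 2 := by
  set W : PowerSeries R := ∏ i, ((1 - PowerSeries.C (w i) * PowerSeries.X) *
    PowerSeries.mk fun k => v i ^ k) with hW
  set P : PowerSeries R := ∑ i, PowerSeries.mk fun k => v i ^ (k + 1) - w i ^ (k + 1) with hP
  have hPc (m : ℕ) : PowerSeries.coeff m P = ∑ i, (v i ^ (m + 1) - w i ^ (m + 1)) := by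
    simp [hP]
  have hder : PowerSeries.derivative R W = P * W :=
    derivation_prod_of_forall _ _ _ _ fun i _ => derivative_one_sub_mul_mk_pow (v i) (w i)
  have hE : PowerSeries.map (Ideal.Quotient.mk I)
        (∏ i, (1 - PowerSeries.C (w i) * PowerSeries.X)) =
      PowerSeries.map (Ideal.Quotient.mk I)
        (∏ i, (1 - PowerSeries.C (v i) * PowerSeries.X)) := by
    simp only [prod_one_sub_eq_sum_esym, map_sum]
    refine Finset.sum_congr rfl fun k hk => ?_
    simp only [map_mul, PowerSeries.map_C]
    congr 3
    cases k with
    | zero => simp [esym]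
    | succ k =>
      exact (Ideal.Quotient.eq.mpr
        (h k (by simpa using hk))).symm
  have hW1 : PowerSeries.map (Ideal.Quotient.mk I) W = 1 := by
    rw [hW, Finset.prod_mul_distrib, map_mul, hE, ← map_mul, mul_comm,
      ← Finset.prod_mul_distrib]
    simp [mk_pow_mul_one_sub]
  have hWc (m : ℕ) : PowerSeries.coeff m (W - 1) ∈ I := by
    rw [← Ideal.Quotient.eq_zero_iff_mem, ← PowerSeries.coeff_map, map_sub, hW1]
    simp
  have hWs (m : ℕ) : PowerSeries.coeff (m + 1) W ∈ I := by
    simpa [PowerSeries.coeff_one] using hWc (m + 1)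
  have hPI (m : ℕ) : PowerSeries.coeff m P ∈ I := by
    have hP0 : PowerSeries.map (Ideal.Quotient.mk I) P = 0 := by
      have := congrArg (PowerSeries.map (Ideal.Quotient.mk I)) hder
      rw [map_mul, hW1, mul_one] at this
      rw [← this]
      ext m
      rw [PowerSeries.coeff_map, PowerSeries.coeff_derivative]
      exact Ideal.Quotient.eq_zero_iff_mem.mpr (I.mul_mem_right _ (hWs m))
    rw [← Ideal.Quotient.eq_zero_iff_mem, ← PowerSeries.coeff_map, hP0, map_zero]
  refine ⟨hPc n ▸ hPI n, PowerSeries.coeff (n + 1) W, hWs n, ?_⟩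
  have hn : (n + 1 : R) * PowerSeries.coeff (n + 1) W - PowerSeries.coeff n P =
      PowerSeries.coeff n (P * (W - 1)) := by
    rw [mul_sub, mul_one, map_sub, ← hder, PowerSeries.coeff_derivative, mul_comm]
  rw [← hPc, hn, PowerSeries.coeff_mul, pow_two]
  exact sum_mem fun p _ => Ideal.mul_mem_mul (hPI _) (hWc _)

/-- The difference `x_i - y_i` in the polynomial ring. -/
def diffXY (r : ℕ) (i : Fin r) : FPoly r := X (Sum.inl i) - X (Sum.inr i)

/-- The substitution `x_i ↦ y_i` for `i ∈ s`. -/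
def substXY {r : ℕ} (s : Finset (Fin r)) : FPoly r →ₐ[ℤ] FPoly r :=
  aeval (Sum.elim (fun i => if i ∈ s then X (Sum.inr i) else X (Sum.inl i))
    fun i => X (Sum.inr i))

lemma substXY_diffXY {r : ℕ} (s : Finset (Fin r)) (i : Fin r) :
    substXY s (diffXY r i) = if i ∈ s then 0 else diffXY r i := by
  by_cases hi : i ∈ s <;> simp [substXY, diffXY, hi]

lemma diffXY_ne_zero {r : ℕ} (i : Fin r) : diffXY r i ≠ 0 :=
  sub_ne_zero.mpr fun h => Sum.inl_ne_inr (X_injective h)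

lemma exists_eq_sum_diffXY_of_substXY_eq_zero {r : ℕ} (s : Finset (Fin r)) (p : FPoly r)
    (hp : substXY s p = 0) : ∃ c : Fin r → FPoly r, p = ∑ i ∈ s, c i * diffXY r i := by
  set J : Ideal (FPoly r) := Ideal.span (diffXY r '' s)
  have hmk : (Ideal.Quotient.mkₐ ℤ J).comp (substXY s) = Ideal.Quotient.mkₐ ℤ J := by
    refine MvPolynomial.algHom_ext fun i => ?_
    rcases i with i | i
    · by_cases hi : i ∈ s
      · have : diffXY r i ∈ J := Ideal.subset_span ⟨i, hi, rfl⟩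
        simpa [substXY, hi] using (Ideal.Quotient.eq.mpr this).symm
      · simp [substXY, hi]
    · simp [substXY]
  have hpJ : p ∈ J := by
    rw [← Ideal.Quotient.eq_zero_iff_mem]
    simpa [hp] using (DFunLike.congr_fun hmk p).symm
  obtain ⟨c, hc⟩ := (Submodule.mem_span_image_finset_iff_exists_fun' (FPoly r)).mp hpJ
  exact ⟨c, hc.symm⟩

/-- Exactness in degree one of the Koszul complex of the sequence `x_i - y_i` in the
polynomial ring. -/
lemma exists_boundary_of_sum_mul_diffXY_eq_zero {r : ℕ} (s : Finset (Fin r))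
    (b : Fin r → FPoly r) (hb : ∑ j ∈ s, b j * diffXY r j = 0) :
    ∃ a : Fin r → Fin r → FPoly r,
      ∀ j ∈ s, b j = ∑ i ∈ s, (a i j - a j i) * diffXY r i := by
  induction s using Finset.induction_on generalizing b with
  | empty => simp
  | insert m s hm ih =>
    rw [Finset.sum_insert hm] at hb
    obtain ⟨w, hw⟩ := exists_eq_sum_diffXY_of_substXY_eq_zero s (b m) <| by
      have := congrArg (substXY s) hb
      rw [map_add, map_mul, map_sum, substXY_diffXY, if_neg hm, map_zero,
        Finset.sum_eq_zero, add_zero] at this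
      · exact (mul_eq_zero.mp this).resolve_right (diffXY_ne_zero m)
      · intro j hj
        rw [map_mul, substXY_diffXY, if_pos hj, mul_zero]
    obtain ⟨a, ha⟩ := ih (fun j => b j + w j * diffXY r m) <| by
      rw [hw, Finset.sum_mul, ← Finset.sum_add_distrib] at hb
      rw [← hb]
      exact Finset.sum_congr rfl fun j _ => by ring
    refine ⟨fun i j => if i = m then 0 else if j = m then w i else a i j, fun j hj => ?_⟩
    have hne : ∀ i ∈ s, i ≠ m := fun i hi h => hm (h ▸ hi)
    rw [Finset.sum_insert hm]
    rcases Finset.mem_insert.mp hj with rfl | hj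
    · rw [hw]
      simp only [if_true, sub_self, zero_mul, zero_add, sub_zero]
      exact Finset.sum_congr rfl fun i hi => by rw [if_neg (hne i hi)]
    · have h1 : ∑ i ∈ s, ((if i = m then 0 else if j = m then w i else a i j) -
          (if j = m then 0 else if i = m then w j else a j i)) * diffXY r i =
          ∑ i ∈ s, (a i j - a j i) * diffXY r i :=
        Finset.sum_congr rfl fun i hi => by simp only [if_neg (hne i hi), if_neg (hne j hj)]
      rw [h1, ← ha j hj]
      simp only [if_true, if_neg (hne j hj)]
      ring

lemma toFQ_eq_zero_of_mem {r : ℕ} {p : FPoly r} (hp : p ∈ Ideal.span (Set.range (Frel r))) :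
    toFQ r p = 0 := by
  have hle : Ideal.span (Set.range (Frel r)) ≤ RingHom.ker (toFQ r) := by
    rw [Ideal.span_le]
    rintro _ ⟨j, rfl⟩
    exact Ideal.Quotient.eq_zero_iff_mem.mpr (Ideal.subset_span ⟨j, rfl⟩)
  exact hle hp

/-- The numerator `Σ_i x_j^i y_j^{n-i}` of the `j`-th coefficient of `κ_n`. -/
def kappaNum (r n : ℕ) (j : Fin r) : FPoly r :=
  ∑ i ∈ Finset.range (n + 1), X (Sum.inl j) ^ i * X (Sum.inr j) ^ (n - i)

lemma kappaNum_mul_diffXY (r n : ℕ) (j : Fin r) :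
    kappaNum r n j * diffXY r j = X (Sum.inl j) ^ (n + 1) - X (Sum.inr j) ^ (n + 1) := by
  simpa [kappaNum, diffXY] using
    (Commute.all (X (Sum.inl j) : FPoly r) (X (Sum.inr j))).geom_sum₂_mul (n + 1)

lemma kappa_eq (r n : ℕ) (j : Fin r) :
    kappa r n j = algebraMap ℚ (FQRing r) (1 / (n + 1)) * toFQ r (kappaNum r n j) := by
  simp [kappa, kappaNum, xQ, yQ]

lemma toFQ_diffXY (r : ℕ) (j : Fin r) : toFQ r (diffXY r j) = xQ r j - yQ r j :=
  map_sub _ _ _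

lemma algebraMap_mul_toFQ_natCast (r n : ℕ) :
    algebraMap ℚ (FQRing r) (1 / (n + 1)) * toFQ r (n + 1) = 1 := by
  have h : toFQ r (n + 1) = algebraMap ℚ (FQRing r) (n + 1) := by simp
  rw [h, ← map_mul, one_div_mul_cancel (by positivity), map_one]

/-- Fix `r ≥ 1` and `n ≥ 1`.  In the Koszul complex
`K(ℚ ⊗ 𝔉; x_1 − y_1, …, x_r − y_r)`, the degree-1 element `κ_n` is a cycle
(its differential `Σ_j κ_j·(x_j − y_j)` vanishes), and there is a degree-1 cycle
`z = Σ_j c_j·x̂_j` of the *integral* Koszul complex `K(𝔉; x − y)` whose image in the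
rational complex is homologous to `κ_n`: the image of `z` minus `κ_n` is the boundary
of a degree-2 element.  (The boundary of the general degree-2 element
`Σ_{i,j} a_{ij}·x̂_i∧x̂_j` has `j`-th coefficient `Σ_i (a_{ij} − a_{ji})·(x_i − y_i)`;
elements of `𝔉` are quantified via representatives `c j ∈ ℤ[x,y]`.) -/
theorem stmt8 (r n : ℕ) (hr : 1 ≤ r) (hn : 1 ≤ n) :
    (∑ j : Fin r, kappa r n j * (xQ r j - yQ r j) = 0) ∧
    ∃ c : Fin r → FPoly r,
      (∑ j : Fin r, Ideal.Quotient.mk _ (c j) * (xZ r j - yZ r j) = 0) ∧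
      ∃ a : Fin r → Fin r → FQRing r,
        ∀ j : Fin r,
          toFQ r (c j) - kappa r n j
            = ∑ i : Fin r, (a i j - a j i) * (xQ r i - yQ r i) := by
  set I : Ideal (FPoly r) := Ideal.span (Set.range (Frel r)) with hI
  obtain ⟨hp, g, hgI, hg⟩ := exists_mem_psum_sub_mem_sq I
    (fun i : Fin r => (X (Sum.inl i) : FPoly r)) (fun i => X (Sum.inr i))
    (fun k hk => Ideal.subset_span ⟨⟨k, by simpa using hk⟩, rfl⟩) n
  simp_rw [← kappaNum_mul_diffXY] at hp hg
  have hIJ (p : FPoly r) (hp : p ∈ I) : substXY Finset.univ p = 0 := by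
    have hle : I ≤ RingHom.ker (substXY (Finset.univ : Finset (Fin r))) := by
      rw [hI, Ideal.span_le]
      rintro _ ⟨j, rfl⟩
      simp [Frel, esym, substXY]
    exact hle hp
  refine ⟨?_, ?_⟩
  · have := toFQ_eq_zero_of_mem hp
    simp only [map_sum, map_mul, toFQ_diffXY] at this
    simp_rw [kappa_eq, mul_assoc, ← Finset.mul_sum, this, mul_zero]
  · obtain ⟨c, hc⟩ := exists_eq_sum_diffXY_of_substXY_eq_zero _ g (hIJ g hgI)
    refine ⟨c, ?_, ?_⟩
    · rw [← Ideal.Quotient.eq_zero_iff_mem, hc, map_sum] at hgI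
      simpa [diffXY, xZ, yZ] using hgI
    · have hJ : I ≤ Ideal.span (Set.range (diffXY r)) := fun p hp => by
        obtain ⟨d, hd⟩ := exists_eq_sum_diffXY_of_substXY_eq_zero _ p (hIJ p hp)
        rw [hd]
        exact sum_mem fun i _ => Ideal.mul_mem_left _ _ (Ideal.subset_span ⟨i, rfl⟩)
      rw [pow_two] at hg
      replace hg := Ideal.mul_mono_right hJ hg
      rw [← smul_eq_mul, Submodule.mem_ideal_smul_span_iff_exists_sum] at hg
      obtain ⟨f, hfI, hf⟩ := hg
      rw [Finsupp.sum_fintype _ _ (by simp)] at hf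
      obtain ⟨a, ha⟩ := exists_boundary_of_sum_mul_diffXY_eq_zero Finset.univ
        (fun j => ((n : FPoly r) + 1) * c j - kappaNum r n j - f j) <| by
          simp only [sub_mul, Finset.sum_sub_distrib, mul_assoc, ← Finset.mul_sum, ← hc]
          exact sub_eq_zero.mpr hf.symm
      set q := algebraMap ℚ (FQRing r) (1 / (n + 1)) with hq
      refine ⟨fun i j => q * toFQ r (a i j), fun j => ?_⟩
      have hj := congrArg (toFQ r) (ha j (Finset.mem_univ j))
      rw [map_sub, map_sub, map_mul, toFQ_eq_zero_of_mem (hfI j), sub_zero, map_sum] at hj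
      simp only [map_mul, map_sub, toFQ_diffXY] at hj
      rw [kappa_eq]
      simp_rw [← mul_sub, mul_assoc, ← Finset.mul_sum]
      rw [← hj, ← hq]
      linear_combination -toFQ r (c j) * algebraMap_mul_toFQ_natCast r n
end
end
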